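/- There exists an absolute constant c₁ > 0 such that for each integer k ≥ 1 there exist constants c_k > 0 and C_k > 0 with: for all real x ≥ y ≥ 2, the inequality f_k(n) ≥ c_k·(log x)^k/ū^{k−1} holds for all n ∈ S(x,y) with at most C_k·e^{−c₁·ū}·Ψ(x,y) exceptions. -/

import Mathlib

open Finset MeasureTheory
open scoped Classical

noncomputable section

/-- The set of primes `p ≤ y`. -/
def primesUpTo (y : ℝ) : Finset ℕ := (Finset.range (⌊y⌋₊ + 1)).filter Nat.Prime

/-- `S(x,y)`: the set of `y`-friable integers in `[1,x]`. -/
def Sf (x y : ℝ) : Finset ℕ :=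
  (Finset.Icc 1 ⌊x⌋₊).filter fun n => ∀ p : ℕ, p.Prime → p ∣ n → (p : ℝ) ≤ y

/-- `Ψ(x,y)`. -/
def Psi (x y : ℝ) : ℝ := (Sf x y).card

/-- `u = log x / log y`. -/
def uQ (x y : ℝ) : ℝ := Real.log x / Real.log y

/-- `ū = min(u, π(y))`. -/
def ubar (x y : ℝ) : ℝ := min (uQ x y) ((primesUpTo y).card)

/-- `ν_{x,y}(A) = |A ∩ S(x,y)| / Ψ(x,y)`. -/
def nuMeas (x y : ℝ) (A : Set ℕ) : ℝ :=
  (((Sf x y).filter fun n => n ∈ A).card : ℝ) / Psi x y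

/-- `P(D_n ≥ t) = #{d ∣ n : log d ≥ t} / τ(n)`. -/
def DnProb (n : ℕ) (t : ℝ) : ℝ :=
  ((n.divisors.filter fun d => t ≤ Real.log d).card : ℝ) / (n.divisors.card : ℝ)

/-- `m_{2,n}`. -/
def m2 (n : ℕ) : ℝ :=
  (1 / 12) * ∑ p ∈ n.primeFactors,
    (n.factorization p : ℝ) * ((n.factorization p : ℝ) + 2) * Real.log p ^ 2

/-- `m_{4,n}`. -/
def m4 (n : ℕ) : ℝ :=
  (1 / 240) * ∑ p ∈ n.primeFactors,
    (n.factorization p : ℝ) * ((n.factorization p : ℝ) + 2) *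
      (3 * (n.factorization p : ℝ) ^ 2 + 6 * (n.factorization p : ℝ) - 4) * Real.log p ^ 4

/-- `σ_n = √(m_{2,n})`. -/
def sigman (n : ℕ) : ℝ := Real.sqrt (m2 n)

/-- `w_n = m_{2,n}² / m_{4,n}`, with `w_1 = 1`. -/
def wn (n : ℕ) : ℝ := if n = 1 then 1 else m2 n ^ 2 / m4 n

/-- `Φ(z) = (1/√(2π)) ∫_z^∞ e^{-t²/2} dt`. -/
def GaussPhi (z : ℝ) : ℝ :=
  (1 / Real.sqrt (2 * Real.pi)) * ∫ t in Set.Ioi z, Real.exp (-t ^ 2 / 2)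

/-- `ω̃_{x,y}(n)`. -/
def omegaTilde (x y : ℝ) (n : ℕ) : ℕ :=
  ((n.primeFactors).filter fun p : ℕ =>
    Real.sqrt y < (p : ℝ) ∧ (p : ℝ) ≤ y ∧
      uQ x y / (2 * ubar x y) ≤ (n.factorization p : ℝ) ∧
      (n.factorization p : ℝ) ≤ 2 * uQ x y / ubar x y).card

/-- The saddle-point equation defining `α(x,y)`. -/
def saddleEq (x y α : ℝ) : Prop :=
  ∑ p ∈ primesUpTo y, Real.log p / ((p : ℝ) ^ α - 1) = Real.log x

/-- `σ̄(x,y)` (in terms of `y` and `α`). -/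
def sigmaBar (y α : ℝ) : ℝ :=
  Real.sqrt ((1 / 2) * ∑ p ∈ primesUpTo y,
    ((p : ℝ) ^ α - 1 / 3) * Real.log p ^ 2 / ((p : ℝ) ^ α - 1) ^ 2)

/-- `ζ(α,y)`. -/
def zetaY (y α : ℝ) : ℝ := ∏ p ∈ primesUpTo y, (1 - (p : ℝ) ^ (-α))⁻¹

/-- `f_k(n) = ∑_{p^ν ‖ n} (ν log p)^k`. -/
def fk (k : ℕ) (n : ℕ) : ℝ :=
  ∑ p ∈ n.primeFactors, ((n.factorization p : ℝ) * Real.log p) ^ k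

/-- `A_f(x,y) = ∑_{p ≤ y} ∑_{ν ≥ 1} f(p^ν) p^{-να} (1 - p^{-α})`. -/
def Af (y α : ℝ) (f : ℕ → ℝ) : ℝ :=
  ∑ p ∈ primesUpTo y, ∑' ν : ℕ,
    f (p ^ (ν + 1)) * (p : ℝ) ^ (-(((ν : ℝ) + 1) * α)) * (1 - (p : ℝ) ^ (-α))

/-- `Z_n(β)` for real `β` (each Euler factor written as the everywhere-defined mean
`(1/(ν+1)) ∑_{0 ≤ j ≤ ν} p^{jβ}`, which is the continuous extension of
`(p^{(ν+1)β}-1)/((ν+1)(p^β-1))`). -/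
def ZnR (n : ℕ) (β : ℝ) : ℝ :=
  ∏ p ∈ n.primeFactors,
    (∑ j ∈ Finset.range (n.factorization p + 1), (p : ℝ) ^ ((j : ℝ) * β)) /
      ((n.factorization p : ℝ) + 1)

/-- `φ_n = log Z_n` on the reals. -/
def phiN (n : ℕ) (β : ℝ) : ℝ := Real.log (ZnR n β)

/-- `Z_n(s)` for complex `s`. -/
def ZnC (n : ℕ) (s : ℂ) : ℂ :=
  ∏ p ∈ n.primeFactors,
    (∑ j ∈ Finset.range (n.factorization p + 1), (p : ℂ) ^ ((j : ℂ) * s)) /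
      ((n.factorization p : ℂ) + 1)

/-- Distance from `θ` to the nearest integer. -/
def nid (θ : ℝ) : ℝ := |θ - round θ|

/-- `V_y(s) = (y^{1-s} - 1)/(1 - s)`, extended by continuity at `s = 1`. -/
def Vy (y : ℝ) (s : ℂ) : ℂ :=
  if s = 1 then (Real.log y : ℂ) else (((y : ℝ) : ℂ) ^ (1 - s) - 1) / (1 - s)

open scoped ArithmeticFunction.vonMangoldt

lemma mem_Sf {x y : ℝ} {n : ℕ} :
    n ∈ Sf x y ↔ n ≠ 0 ∧ (n : ℝ) ≤ x ∧ ∀ p : ℕ, p.Prime → p ∣ n → (p : ℝ) ≤ y := by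
  simp only [Sf, Finset.mem_filter, Finset.mem_Icc, and_assoc, Nat.one_le_iff_ne_zero]
  refine and_congr_right fun hn => ?_
  rw [Nat.le_floor_iff' hn]

lemma mem_primesUpTo {y : ℝ} {p : ℕ} : p ∈ primesUpTo y ↔ p.Prime ∧ (p : ℝ) ≤ y := by
  simp only [primesUpTo, Finset.mem_filter, Finset.mem_range, Nat.lt_succ_iff]
  rw [and_comm]
  refine and_congr_right fun hp => ?_
  rw [Nat.le_floor_iff' hp.ne_zero]

lemma one_le_card_primesUpTo {y : ℝ} (hy : 2 ≤ y) : (1 : ℝ) ≤ (primesUpTo y).card := by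
  have : 0 < (primesUpTo y).card :=
    Finset.card_pos.2 ⟨2, mem_primesUpTo.2 ⟨Nat.prime_two, by exact_mod_cast hy⟩⟩
  exact_mod_cast this

lemma Psi_nonneg (x y : ℝ) : 0 ≤ Psi x y := Nat.cast_nonneg _

lemma Sf_mono {x x' : ℝ} (h : x ≤ x') (y : ℝ) : Sf x y ⊆ Sf x' y := fun _ hn =>
  mem_Sf.2 ⟨(mem_Sf.1 hn).1, (mem_Sf.1 hn).2.1.trans h, (mem_Sf.1 hn).2.2⟩

lemma Psi_mono {x x' : ℝ} (h : x ≤ x') (y : ℝ) : Psi x y ≤ Psi x' y := by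
  unfold Psi
  exact_mod_cast Finset.card_le_card (Sf_mono h y)

lemma Sf_eq_empty {x : ℝ} (hx : x < 1) (y : ℝ) : Sf x y = ∅ := by
  refine Finset.eq_empty_of_forall_notMem fun n hn => ?_
  have h1 : (1 : ℝ) ≤ n := by exact_mod_cast Nat.one_le_iff_ne_zero.2 (mem_Sf.1 hn).1
  linarith [(mem_Sf.1 hn).2.1]

lemma Psi_eq_zero {x : ℝ} (hx : x < 1) (y : ℝ) : Psi x y = 0 := by
  simp [Psi, Sf_eq_empty hx]

lemma one_le_of_mem_Sf {x y : ℝ} {n : ℕ} (hn : n ∈ Sf x y) : (1 : ℝ) ≤ n := by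
  exact_mod_cast Nat.one_le_iff_ne_zero.2 (mem_Sf.1 hn).1

lemma mul_mem_Sf {x y : ℝ} {d m : ℕ} :
    d * m ∈ Sf x y ↔ d ∈ Sf x y ∧ m ∈ Sf (x / d) y := by
  simp only [mem_Sf]
  constructor
  · rintro ⟨h0, hle, hp⟩
    have hd : d ≠ 0 := left_ne_zero_of_mul h0
    have hm : m ≠ 0 := right_ne_zero_of_mul h0
    have hd' : (0 : ℝ) < d := by exact_mod_cast Nat.pos_of_ne_zero hd
    refine ⟨⟨hd, le_trans ?_ hle, fun p pp h => hp p pp (h.mul_right _)⟩, hm, ?_,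
      fun p pp h => hp p pp (h.mul_left _)⟩
    · exact_mod_cast Nat.le_mul_of_pos_right d (Nat.pos_of_ne_zero hm)
    · rw [le_div_iff₀ hd', mul_comm]
      exact_mod_cast hle
  · rintro ⟨⟨hd, -, hp⟩, hm, hle, hp'⟩
    have hd' : (0 : ℝ) < d := by exact_mod_cast Nat.pos_of_ne_zero hd
    refine ⟨mul_ne_zero hd hm, ?_, fun p pp h => ?_⟩
    · rw [le_div_iff₀ hd', mul_comm] at hle
      exact_mod_cast hle
    · rcases (pp.dvd_mul).1 h with h | h
      exacts [hp p pp h, hp' p pp h]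

lemma sum_Sf_divisorsAntidiagonal (x y : ℝ) (f : ℕ → ℕ → ℝ) :
    ∑ n ∈ Sf x y, ∑ q ∈ n.divisorsAntidiagonal, f q.1 q.2 =
      ∑ d ∈ Sf x y, ∑ m ∈ Sf (x / d) y, f d m := by
  rw [Finset.sum_sigma', Finset.sum_sigma']
  refine Finset.sum_bij' (fun a _ => ⟨a.2.1, a.2.2⟩) (fun a _ => ⟨a.1 * a.2, (a.1, a.2)⟩)
    ?_ ?_ ?_ ?_ ?_
  · rintro ⟨n, d, m⟩ h
    simp only [Finset.mem_sigma, Nat.mem_divisorsAntidiagonal] at h ⊢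
    obtain ⟨h1, rfl, h3⟩ := h
    exact mul_mem_Sf.1 h1
  · rintro ⟨d, m⟩ h
    simp only [Finset.mem_sigma, Nat.mem_divisorsAntidiagonal] at h ⊢
    have := mul_mem_Sf.2 h
    exact ⟨this, trivial, (mem_Sf.1 this).1⟩
  · rintro ⟨n, d, m⟩ h
    simp only [Finset.mem_sigma, Nat.mem_divisorsAntidiagonal] at h ⊢
    obtain ⟨h1, rfl, h3⟩ := h
    rfl
  · rintro ⟨d, m⟩ h
    rfl
  · rintro ⟨n, d, m⟩ h
    rfl

lemma sum_Sf_comm (x y : ℝ) (f : ℕ → ℕ → ℝ) :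
    ∑ d ∈ Sf x y, ∑ m ∈ Sf (x / d) y, f d m = ∑ m ∈ Sf x y, ∑ d ∈ Sf (x / m) y, f d m := by
  refine Finset.sum_comm' fun d m => ?_
  rw [← mul_mem_Sf, mul_comm, mul_mem_Sf, and_comm]

/-- The sum of the von Mangoldt function over the `y`-friable integers up to `v`. -/
def friablePsi (v y : ℝ) : ℝ := ∑ d ∈ Sf v y, Λ d

lemma log_eq_sum_divisorsAntidiagonal (n : ℕ) :
    Real.log n = ∑ q ∈ n.divisorsAntidiagonal, Λ q.1 := by
  rw [← ArithmeticFunction.vonMangoldt_sum, Nat.sum_divisorsAntidiagonal fun d _ => Λ d]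

lemma sum_log_Sf_eq_sum_mul_Psi (x y : ℝ) :
    ∑ n ∈ Sf x y, Real.log n = ∑ d ∈ Sf x y, Λ d * Psi (x / d) y := by
  simp_rw [log_eq_sum_divisorsAntidiagonal]
  rw [sum_Sf_divisorsAntidiagonal x y fun d _ => Λ d]
  refine Finset.sum_congr rfl fun d _ => ?_
  rw [Finset.sum_const, nsmul_eq_mul, mul_comm, Psi]

lemma sum_log_Sf_eq_sum_friablePsi (x y : ℝ) :
    ∑ n ∈ Sf x y, Real.log n = ∑ m ∈ Sf x y, friablePsi (x / m) y := by
  simp_rw [log_eq_sum_divisorsAntidiagonal]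
  rw [sum_Sf_divisorsAntidiagonal x y fun d _ => Λ d, sum_Sf_comm]
  rfl

lemma sum_log_Sf_le (x y : ℝ) : ∑ n ∈ Sf x y, Real.log n ≤ Real.log x * Psi x y := by
  rw [mul_comm, Psi, ← nsmul_eq_mul]
  refine Finset.sum_le_card_nsmul _ _ _ fun n hn => ?_
  exact Real.log_le_log (by linarith [one_le_of_mem_Sf hn]) (mem_Sf.1 hn).2.1

lemma sum_mul_Psi_le {x y : ℝ} {s : Finset ℕ} (hs : ∀ d ∈ s, (d : ℝ) ≤ y) :
    ∑ d ∈ s, Λ d * Psi (x / d) y ≤ Real.log x * Psi x y := by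
  refine le_trans ?_ (sum_log_Sf_le x y)
  rw [sum_log_Sf_eq_sum_mul_Psi]
  rw [← Finset.sum_filter_ne_zero]
  refine Finset.sum_le_sum_of_subset_of_nonneg (fun d hd => ?_) fun d _ _ =>
    mul_nonneg ArithmeticFunction.vonMangoldt_nonneg (Psi_nonneg _ _)
  obtain ⟨hd, h⟩ := Finset.mem_filter.1 hd
  have hd0 : d ≠ 0 := by rintro rfl; simp at h
  have hd' : (0 : ℝ) < d := by exact_mod_cast Nat.pos_of_ne_zero hd0
  refine mem_Sf.2 ⟨hd0, ?_, fun p _ hpd => le_trans ?_ (hs d hd)⟩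
  · by_contra hlt
    rw [not_le] at hlt
    rw [Psi_eq_zero ((div_lt_one hd').2 hlt)] at h
    simp at h
  · exact_mod_cast Nat.le_of_dvd (Nat.pos_of_ne_zero hd0) hpd

lemma friablePsi_nonneg (v y : ℝ) : 0 ≤ friablePsi v y :=
  Finset.sum_nonneg fun _ _ => ArithmeticFunction.vonMangoldt_nonneg

lemma friablePsi_le_psi (v y : ℝ) : friablePsi v y ≤ Chebyshev.psi v := by
  unfold friablePsi Chebyshev.psi
  refine Finset.sum_le_sum_of_subset_of_nonneg (fun n hn => ?_)
    fun _ _ _ => ArithmeticFunction.vonMangoldt_nonneg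
  have := mem_Sf.1 hn
  exact Finset.mem_Ioc.2 ⟨Nat.pos_of_ne_zero this.1, (Nat.le_floor_iff' this.1).2 this.2.1⟩

lemma psi_le_friablePsi {v y : ℝ} (h : v ≤ y) : Chebyshev.psi v ≤ friablePsi v y := by
  unfold friablePsi Chebyshev.psi
  refine Finset.sum_le_sum_of_subset_of_nonneg (fun n hn => ?_)
    fun _ _ _ => ArithmeticFunction.vonMangoldt_nonneg
  rw [Finset.mem_Ioc] at hn
  have hn0 : n ≠ 0 := hn.1.ne'
  have hnv : (n : ℝ) ≤ v := (Nat.le_floor_iff' hn0).1 hn.2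
  refine mem_Sf.2 ⟨hn0, hnv, fun p _ hp => ?_⟩
  have : (p : ℝ) ≤ n := by exact_mod_cast Nat.le_of_dvd hn.1 hp
  linarith

lemma friablePsi_eq_sum (v y : ℝ) :
    friablePsi v y = ∑ p ∈ primesUpTo y, (Nat.log p ⌊v⌋₊ : ℝ) * Real.log p := by
  have key : friablePsi v y = ∑ d ∈ (primesUpTo y).biUnion
      (fun p => (Finset.Icc 1 (Nat.log p ⌊v⌋₊)).image (p ^ ·)), Λ d := by
    refine (Finset.sum_subset (fun q hq => ?_) fun n hn hn' => ?_).symm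
    · simp only [Finset.mem_biUnion, Finset.mem_image, Finset.mem_Icc, mem_primesUpTo] at hq
      obtain ⟨p, ⟨pp, hpy⟩, k, ⟨hk1, hk⟩, rfl⟩ := hq
      have hv : ⌊v⌋₊ ≠ 0 := by
        rintro h
        rw [h, Nat.log_zero_right] at hk
        omega
      refine mem_Sf.2 ⟨pow_ne_zero _ pp.ne_zero, ?_, fun r rp hr => ?_⟩
      · exact (Nat.le_floor_iff' (pow_ne_zero _ pp.ne_zero)).1 (Nat.pow_le_of_le_log hv hk)
      · rwa [(Nat.prime_dvd_prime_iff_eq rp pp).1 (rp.dvd_of_dvd_pow hr)]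
    · by_contra hne
      obtain ⟨p, k, pp, hk, rfl⟩ :=
        (isPrimePow_nat_iff _).1 (ArithmeticFunction.vonMangoldt_ne_zero_iff.1 hne)
      obtain ⟨h0, hle, hp⟩ := mem_Sf.1 hn
      refine hn' ?_
      simp only [Finset.mem_biUnion, Finset.mem_image, Finset.mem_Icc, mem_primesUpTo]
      exact ⟨p, ⟨pp, hp p pp (dvd_pow_self p hk.ne')⟩, k,
        ⟨hk, Nat.le_log_of_pow_le pp.one_lt ((Nat.le_floor_iff' h0).2 hle)⟩, rfl⟩
  rw [key, Finset.sum_biUnion]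
  · refine Finset.sum_congr rfl fun p hp => ?_
    have pp := (mem_primesUpTo.1 hp).1
    rw [Finset.sum_image fun a _ b _ hab => Nat.pow_right_injective pp.two_le hab]
    rw [Finset.sum_congr rfl fun k hk => by
      rw [ArithmeticFunction.vonMangoldt_apply_pow (by have := Finset.mem_Icc.1 hk; omega),
        ArithmeticFunction.vonMangoldt_apply_prime pp]]
    simp
  · intro p hp r hr hne
    have pp := (mem_primesUpTo.1 hp).1
    have rp := (mem_primesUpTo.1 hr).1
    refine Finset.disjoint_left.2 fun a ha hb => hne ?_
    simp only [Finset.mem_image, Finset.mem_Icc] at ha hb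
    obtain ⟨i, hi, rfl⟩ := ha
    obtain ⟨j, hj, h⟩ := hb
    have h1 : r ∣ p ^ i := h ▸ dvd_pow_self r (by omega)
    exact ((Nat.prime_dvd_prime_iff_eq rp pp).1 (rp.dvd_of_dvd_pow h1)).symm

lemma friablePsi_le_card_mul_log {v : ℝ} (hv : 1 ≤ v) (y : ℝ) :
    friablePsi v y ≤ (primesUpTo y).card * Real.log v := by
  rw [friablePsi_eq_sum, ← nsmul_eq_mul]
  refine Finset.sum_le_card_nsmul _ _ _ fun p hp => ?_
  have pp := (mem_primesUpTo.1 hp).1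
  have hfl : ⌊v⌋₊ ≠ 0 := (Nat.floor_pos.2 hv).ne'
  rw [← Real.log_pow]
  refine Real.log_le_log (pow_pos (by exact_mod_cast pp.pos) _) ?_
  calc (p : ℝ) ^ Nat.log p ⌊v⌋₊ = ((p ^ Nat.log p ⌊v⌋₊ : ℕ) : ℝ) := by push_cast; rfl
    _ ≤ ⌊v⌋₊ := by exact_mod_cast Nat.pow_log_le_self p hfl
    _ ≤ v := Nat.floor_le (by linarith)

lemma card_mul_log_le_friablePsi {v y : ℝ} (hv : y ≤ v) :
    (primesUpTo y).card * (Real.log v / 2) ≤ friablePsi v y := by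
  rw [friablePsi_eq_sum, ← nsmul_eq_mul]
  refine Finset.card_nsmul_le_sum _ _ _ fun p hp => ?_
  obtain ⟨pp, hpy⟩ := mem_primesUpTo.1 hp
  set L := Nat.log p ⌊v⌋₊ with hL
  have h2 : (2 : ℝ) ≤ p := by exact_mod_cast pp.two_le
  have hL1 : 1 ≤ L :=
    Nat.le_log_of_pow_le pp.one_lt (by
      rw [pow_one]; exact (Nat.le_floor_iff' pp.ne_zero).2 (hpy.trans hv))
  have hlt : v < (p : ℝ) ^ (L + 1) := by
    have h := Nat.lt_pow_succ_log_self pp.one_lt ⌊v⌋₊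
    have := (Nat.floor_lt' (pow_ne_zero _ pp.ne_zero)).1 h
    exact_mod_cast this
  have hlog : Real.log v ≤ (L + 1) * Real.log p := by
    have := Real.log_le_log (by linarith) hlt.le
    rw [Real.log_pow] at this
    exact_mod_cast this
  have hL1' : (1 : ℝ) ≤ L := by exact_mod_cast hL1
  have hp0 : 0 ≤ Real.log p := Real.log_nonneg (by linarith)
  nlinarith

lemma div_le_psi {v : ℝ} (hv : 2 ≤ v) : v / 16 ≤ Chebyshev.psi v := by
  have l2 := Real.log_two_gt_d9
  have l2' := Real.log_two_lt_d9
  rcases le_total v 8 with h8 | h8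
  · have h := Chebyshev.psi_mono hv
    have : Chebyshev.psi 2 = Real.log 2 := by
      rw [show (2 : ℝ) = ((2 : ℕ) : ℝ) by norm_num, Chebyshev.psi, Nat.floor_natCast]
      rw [show Finset.Ioc 0 2 = {1, 2} by rfl]
      simp [ArithmeticFunction.vonMangoldt_apply_prime Nat.prime_two]
    linarith
  · have h := Chebyshev.psi_ge' (x := v) (by linarith)
    have h1 := Real.log_le_sub_one_of_pos (x := (v + 2) / 8) (by linarith)
    rw [Real.log_div (by linarith) (by norm_num), show (8 : ℝ) = 2 ^ 3 by norm_num,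
      Real.log_pow] at h1
    push_cast at h1
    nlinarith

lemma exists_log_add_friablePsi_le :
    ∃ C ≥ (1 : ℝ), (∀ v y : ℝ, 1 ≤ v → Real.log v + friablePsi v y ≤ C * v) ∧
      ∀ v y r : ℝ, 2 ≤ y → 2 ≤ v → 1 ≤ r →
        Real.log (r * v) + friablePsi (r * v) y ≤ C * (r * friablePsi v y) := by
  have l2 := Real.log_two_gt_d9
  have hup : ∀ v y : ℝ, 1 ≤ v → Real.log v + friablePsi v y ≤ (Real.log 4 + 5) * v := by
    intro v y hv
    have h1 := Real.log_le_sub_one_of_pos (x := v) (by linarith)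
    have h2 := Chebyshev.psi_le_const_mul_self (x := v) (by linarith)
    have h3 := friablePsi_le_psi v y
    linarith
  have h4 : 0 ≤ Real.log 4 := Real.log_nonneg (by norm_num)
  refine ⟨16 * (Real.log 4 + 5), by linarith, fun v y hv => (hup v y hv).trans ?_, ?_⟩
  · nlinarith
  intro v y r hy hv hr
  have hrv : 1 ≤ r * v := by nlinarith
  rcases le_total v y with hvy | hvy
  · have h1 := (div_le_psi hv).trans (psi_le_friablePsi hvy)
    calc _ ≤ _ := hup _ y hrv
      _ = (16 * (Real.log 4 + 5)) * (r * (v / 16)) := by ring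
      _ ≤ _ := by gcongr
  · have h1 := friablePsi_le_card_mul_log hrv y
    have h2 := card_mul_log_le_friablePsi hvy
    have h3 := one_le_card_primesUpTo hy
    have hlv : Real.log 2 ≤ Real.log v := Real.log_le_log (by norm_num) hv
    have hlr := Real.log_le_sub_one_of_pos (x := r) (by linarith)
    have hl : Real.log (r * v) ≤ 3 * (r * Real.log v) := by
      rw [Real.log_mul (by linarith) (by linarith)]
      nlinarith
    have hl0 : 0 ≤ Real.log (r * v) := Real.log_nonneg hrv
    have hf := friablePsi_nonneg v y
    calc Real.log (r * v) + friablePsi (r * v) y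
        ≤ 2 * ((primesUpTo y).card * Real.log (r * v)) := by nlinarith
      _ ≤ 2 * ((primesUpTo y).card * (3 * (r * Real.log v))) := by gcongr
      _ = 12 * (r * ((primesUpTo y).card * (Real.log v / 2))) := by ring
      _ ≤ 12 * (r * friablePsi v y) := by gcongr
      _ ≤ _ := by
        have : 0 ≤ r * friablePsi v y := by positivity
        nlinarith

lemma two_mul_Psi_div_le {x y z : ℝ} (hx : 0 < x) (hy : 2 ≤ y) (hz : y ≤ z)
    (hxz : Real.log x ≤ (primesUpTo y).card * Real.log z) :
    2 * Psi (x / z ^ 4) y ≤ Psi x y := by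
  have hz0 : 0 < z := by linarith
  have hz1 : 1 ≤ z := by linarith
  rcases lt_or_ge (x / z ^ 4) 1 with h | h
  · rw [Psi_eq_zero h, mul_zero]
    exact Psi_nonneg _ _
  have hzx : z ^ 4 ≤ x := (one_le_div (by positivity)).1 h
  have hyz : y ≤ z ^ 4 := hz.trans (le_self_pow₀ hz1 (by norm_num))
  have h1 : friablePsi (z ^ 4) y * Psi (x / z ^ 4) y ≤ Real.log x * Psi x y := by
    refine le_trans ?_ (sum_log_Sf_le x y)
    rw [sum_log_Sf_eq_sum_mul_Psi, friablePsi, Finset.sum_mul]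
    refine le_trans ?_ (Finset.sum_le_sum_of_subset_of_nonneg (Sf_mono hzx y) fun d _ _ =>
      mul_nonneg ArithmeticFunction.vonMangoldt_nonneg (Psi_nonneg _ _))
    refine Finset.sum_le_sum fun d hd => ?_
    refine mul_le_mul_of_nonneg_left (Psi_mono ?_ y) ArithmeticFunction.vonMangoldt_nonneg
    exact div_le_div_of_nonneg_left hx.le (by linarith [one_le_of_mem_Sf hd]) (mem_Sf.1 hd).2.1
  have h2 := card_mul_log_le_friablePsi hyz
  rw [Real.log_pow] at h2
  push_cast at h2
  have hlz : 0 < (primesUpTo y).card * Real.log z :=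
    mul_pos (by linarith [one_le_card_primesUpTo hy]) (Real.log_pos (by linarith))
  have h3 : (primesUpTo y).card * Real.log z * (2 * Psi (x / z ^ 4) y) ≤
      (primesUpTo y).card * Real.log z * Psi x y := by
    calc _ = ((primesUpTo y).card * (4 * Real.log z / 2)) * Psi (x / z ^ 4) y := by ring
      _ ≤ friablePsi (z ^ 4) y * Psi (x / z ^ 4) y :=
        mul_le_mul_of_nonneg_right h2 (Psi_nonneg _ _)
      _ ≤ _ := h1
      _ ≤ _ := mul_le_mul_of_nonneg_right hxz (Psi_nonneg _ _)
  exact le_of_mul_le_mul_left h3 hlz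

lemma Psi_div_pow_le {x y z : ℝ} (hx : 0 < x) (hy : 2 ≤ y) (hz : y ≤ z)
    (hxz : Real.log x ≤ (primesUpTo y).card * Real.log z) (j : ℕ) :
    Psi (x / (z ^ 4) ^ j) y ≤ (1 / 2) ^ j * Psi x y := by
  have hz1 : 1 ≤ z := by linarith
  induction j with
  | zero => simp
  | succ j ih =>
    have hle : x / (z ^ 4) ^ j ≤ x := div_le_self hx.le (one_le_pow₀ (one_le_pow₀ hz1))
    have hpos : 0 < x / (z ^ 4) ^ j := by positivity
    have h := two_mul_Psi_div_le hpos hy hz ((Real.log_le_log hpos hle).trans hxz)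
    rw [div_div, ← pow_succ] at h
    calc _ ≤ (1 / 2) * ((1 / 2) ^ j * Psi x y) := by linarith
      _ = _ := by ring

lemma log_mul_Psi_le {x : ℝ} (hx : 0 < x) (y : ℝ) :
    Real.log x * Psi x y = ∑ n ∈ Sf x y, (Real.log (x / n) + friablePsi (x / n) y) := by
  rw [Finset.sum_add_distrib, ← sum_log_Sf_eq_sum_friablePsi, ← Finset.sum_add_distrib, mul_comm,
    Psi, ← nsmul_eq_mul, ← Finset.sum_const]
  refine Finset.sum_congr rfl fun n hn => ?_
  rw [Real.log_div hx.ne' (by linarith [one_le_of_mem_Sf hn])]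
  ring

lemma exists_Psi_two_pow_mul_le :
    ∃ C ≥ (1 : ℝ), ∀ (y τ : ℝ) (J : ℕ), 2 ≤ y → 0 < τ → C * (J + 1) ≤ Real.log τ →
      ∀ j ≤ J, Psi (2 ^ j * τ) y ≤ C * (2 ^ j * Psi τ y) := by
  obtain ⟨C, hC1, hC, hC'⟩ := exists_log_add_friablePsi_le
  refine ⟨4 * C, by linarith, fun y τ J hy hτ hJ => ?_⟩
  have hJ0 : (0 : ℝ) ≤ J := Nat.cast_nonneg J
  have hlog : 0 < Real.log τ := lt_of_lt_of_le (by positivity) hJ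
  obtain ⟨j, hj, hmax⟩ := Finset.exists_max_image (Finset.range (J + 1))
    (fun i => Psi (2 ^ i * τ) y / 2 ^ i) ⟨0, by simp⟩
  set B := Psi (2 ^ j * τ) y / 2 ^ j with hB
  have hB0 : 0 ≤ B := div_nonneg (Psi_nonneg _ _) (by positivity)
  have hjJ : j ≤ J := Nat.lt_succ_iff.1 (Finset.mem_range.1 hj)
  have hi : ∀ i ≤ J, Psi (2 ^ i * τ) y ≤ 2 ^ i * B := by
    intro i hi
    have := hmax i (Finset.mem_range.2 (Nat.lt_succ_iff.2 hi))
    rwa [div_le_iff₀ (by positivity), mul_comm B] at this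
  suffices hfin : B ≤ 4 * C * Psi τ y by
    intro i hiJ
    calc _ ≤ 2 ^ i * B := hi i hiJ
      _ ≤ 2 ^ i * (4 * C * Psi τ y) := by gcongr
      _ = _ := by ring
  have h2j : (1 : ℝ) ≤ 2 ^ j := one_le_pow₀ (by norm_num)
  have hpt : ∀ n ∈ Sf (2 ^ j * τ) y,
      Real.log (2 ^ j * τ / n) + friablePsi (2 ^ j * τ / n) y ≤
        C * (2 ^ j * friablePsi (τ / n) y) +
          ∑ i ∈ Finset.range (j + 1),
            C * (2 * 2 ^ j / 2 ^ i) * (if (n : ℝ) ≤ 2 ^ i * τ then 1 else 0) := by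
    intro n hn
    have hn1 := one_le_of_mem_Sf hn
    have hn0 : (0 : ℝ) < n := by linarith
    have hnX := (mem_Sf.1 hn).2.1
    have hterm : ∀ i ∈ Finset.range (j + 1),
        0 ≤ C * (2 * 2 ^ j / 2 ^ i) * (if (n : ℝ) ≤ 2 ^ i * τ then 1 else 0) := by
      intro i _
      split_ifs <;> positivity
    have hfr : 0 ≤ C * (2 ^ j * friablePsi (τ / n) y) := by
      have := friablePsi_nonneg (τ / n) y
      positivity
    rcases le_or_gt (n : ℝ) (τ / 2) with hle | hgt
    · have h2 : 2 ≤ τ / n := by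
        rw [le_div_iff₀ hn0]
        linarith
      have := hC' (τ / n) y (2 ^ j) hy h2 h2j
      rw [← mul_div_assoc] at this
      linarith [Finset.sum_nonneg hterm]
    · have hex : ∃ i, (n : ℝ) ≤ 2 ^ i * τ := ⟨j, hnX⟩
      set i := Nat.find hex with hidef
      have hspec : (n : ℝ) ≤ 2 ^ i * τ := Nat.find_spec hex
      have hij : i ≤ j := Nat.find_min' hex hnX
      have hlow : 2 ^ i * τ ≤ 2 * n := by
        rcases Nat.eq_zero_or_pos i with h0 | hpos
        · rw [h0, pow_zero]
          linarith
        · obtain ⟨m, hm⟩ := Nat.exists_eq_succ_of_ne_zero hpos.ne'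
          have := Nat.find_min hex (m := m) (by omega)
          rw [hm, pow_succ]
          push Not at this
          linarith
      have hXn : 2 ^ j * τ / n ≤ 2 * 2 ^ j / 2 ^ i := by
        rw [div_le_div_iff₀ hn0 (by positivity)]
        nlinarith
      have h1 := hC (2 ^ j * τ / n) y ((one_le_div hn0).2 hnX)
      have h2 := Finset.single_le_sum hterm (Finset.mem_range.2 (Nat.lt_succ_iff.2 hij))
      rw [if_pos hspec, mul_one] at h2
      have h3 : C * (2 ^ j * τ / n) ≤ C * (2 * 2 ^ j / 2 ^ i) := by gcongr
      linarith
  have hτX : τ ≤ 2 ^ j * τ := le_mul_of_one_le_left hτ.le h2j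
  have hsum := Finset.sum_le_sum hpt
  rw [← log_mul_Psi_le (by positivity), Finset.sum_add_distrib, ← Finset.mul_sum,
    ← Finset.mul_sum, Finset.sum_comm] at hsum
  have hA : ∑ n ∈ Sf (2 ^ j * τ) y, friablePsi (τ / n) y ≤ Real.log τ * Psi τ y := by
    refine le_trans (le_of_eq ?_) (sum_log_Sf_le τ y)
    rw [sum_log_Sf_eq_sum_friablePsi]
    refine (Finset.sum_subset (Sf_mono hτX y) fun n hn hn' => ?_).symm
    have hn0 : (0 : ℝ) < n := by linarith [one_le_of_mem_Sf hn]
    have hlt : τ / n < 1 := by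
      rw [div_lt_one hn0]
      by_contra hle
      exact hn' (mem_Sf.2 ⟨(mem_Sf.1 hn).1, not_lt.1 hle, (mem_Sf.1 hn).2.2⟩)
    rw [friablePsi, Sf_eq_empty hlt, Finset.sum_empty]
  have hD : ∑ i ∈ Finset.range (j + 1), ∑ n ∈ Sf (2 ^ j * τ) y,
      C * (2 * 2 ^ j / 2 ^ i) * (if (n : ℝ) ≤ 2 ^ i * τ then 1 else 0) ≤
        (J + 1) * (2 * C * 2 ^ j * B) := by
    have hjJ' : (j : ℝ) ≤ J := by exact_mod_cast hjJ
    calc _ ≤ ∑ i ∈ Finset.range (j + 1), 2 * C * 2 ^ j * B := by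
          refine Finset.sum_le_sum fun i hir => ?_
          rw [← Finset.mul_sum, Finset.sum_boole]
          have hcard : (((Sf (2 ^ j * τ) y).filter fun n : ℕ => (n : ℝ) ≤ 2 ^ i * τ).card : ℝ) ≤
              Psi (2 ^ i * τ) y := by
            unfold Psi
            refine Nat.cast_le.2 (Finset.card_le_card fun n hn => ?_)
            obtain ⟨h1, h2⟩ := Finset.mem_filter.1 hn
            exact mem_Sf.2 ⟨(mem_Sf.1 h1).1, h2, (mem_Sf.1 h1).2.2⟩
          have hiJ : i ≤ J := by have := Finset.mem_range.1 hir; omega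
          calc _ ≤ C * (2 * 2 ^ j / 2 ^ i) * (2 ^ i * B) := by
                gcongr
                exact hcard.trans (hi i hiJ)
            _ = _ := by field_simp
      _ = (j + 1) * (2 * C * 2 ^ j * B) := by simp
      _ ≤ _ := by gcongr
  have hXB : Psi (2 ^ j * τ) y = 2 ^ j * B := by
    rw [hB]
    field_simp
  have hlogX : Real.log τ ≤ Real.log (2 ^ j * τ) := Real.log_le_log hτ hτX
  have hmain : 2 ^ j * (Real.log τ * B) ≤
      2 ^ j * (C * (Real.log τ * Psi τ y) + (J + 1) * (2 * C * B)) := by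
    calc _ = Real.log τ * (2 ^ j * B) := by ring
      _ ≤ Real.log (2 ^ j * τ) * Psi (2 ^ j * τ) y := by
        rw [hXB]
        gcongr
      _ ≤ _ := hsum
      _ ≤ C * (2 ^ j * (Real.log τ * Psi τ y)) + (J + 1) * (2 * C * 2 ^ j * B) := by
        gcongr
      _ = _ := by ring
  have hmain' := le_of_mul_le_mul_left hmain (by positivity)
  have hP := Psi_nonneg τ y
  have : Real.log τ * B ≤ Real.log τ * (4 * C * Psi τ y) := by nlinarith
  exact le_of_mul_le_mul_left this hlog

lemma exists_Psi_mul_le :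
    ∃ C ≥ (1 : ℝ), ∀ y τ r : ℝ, 2 ≤ y → 0 < τ → C * Real.log y ≤ Real.log τ → 1 ≤ r → r ≤ y →
      Psi (r * τ) y ≤ C * (r * Psi τ y) := by
  obtain ⟨C, hC1, hC⟩ := exists_Psi_two_pow_mul_le
  refine ⟨5 * C, by linarith, fun y τ r hy hτ hlog hr hry => ?_⟩
  have l2 := Real.log_two_gt_d9
  obtain ⟨n, hn, hn'⟩ := exists_nat_pow_near hr one_lt_two
  have hnlog : n * Real.log 2 ≤ Real.log y := by
    rw [← Real.log_pow]
    exact Real.log_le_log (by positivity) (hn.trans hry)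
  have hy2 : Real.log 2 ≤ Real.log y := Real.log_le_log (by norm_num) hy
  have hn0 : (0 : ℝ) ≤ n := Nat.cast_nonneg n
  have h := hC y τ (n + 1) hy hτ (by
    push_cast
    have : (n : ℝ) + 1 + 1 ≤ 5 * Real.log y := by nlinarith
    nlinarith) (n + 1) le_rfl
  have hP := Psi_nonneg τ y
  calc Psi (r * τ) y ≤ Psi (2 ^ (n + 1) * τ) y := Psi_mono (by gcongr) y
    _ ≤ C * (2 ^ (n + 1) * Psi τ y) := h
    _ ≤ C * ((2 * r) * Psi τ y) := by
      gcongr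
      rw [pow_succ]
      linarith
    _ ≤ _ := by
      have : 0 ≤ C * (r * Psi τ y) := by positivity
      nlinarith

lemma Psi_le_self {v : ℝ} (hv : 0 ≤ v) (y : ℝ) : Psi v y ≤ v := by
  refine le_trans ?_ (Nat.floor_le hv)
  unfold Psi
  have := Finset.card_filter_le (Finset.Icc 1 ⌊v⌋₊) fun n : ℕ =>
    ∀ p : ℕ, p.Prime → p ∣ n → (p : ℝ) ≤ y
  rw [Nat.card_Icc, Nat.add_sub_cancel] at this
  exact Nat.cast_le.2 this

lemma sub_one_le_Psi {v y : ℝ} (h : v ≤ y) : v - 1 ≤ Psi v y := by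
  have hS : Sf v y = Finset.Icc 1 ⌊v⌋₊ := by
    refine Finset.filter_true_of_mem fun n hn p _ hp => ?_
    rw [Finset.mem_Icc] at hn
    have h1 : (n : ℝ) ≤ v := (Nat.le_floor_iff' (by omega)).1 hn.2
    have h2 : (p : ℝ) ≤ n := by exact_mod_cast Nat.le_of_dvd hn.1 hp
    linarith
  rw [Psi, hS, Nat.card_Icc, Nat.add_sub_cancel]
  exact (Nat.sub_one_lt_floor v).le

lemma exists_sum_vonMangoldt_div_le :
    ∃ C ≥ (0 : ℝ), ∀ v y : ℝ, 1 ≤ v → v ≤ y → ∑ d ∈ Sf v y, Λ d / d ≤ Real.log v + C := by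
  have h4 : 0 ≤ Real.log 4 := Real.log_nonneg (by norm_num)
  refine ⟨Real.log 4 + 4, by linarith, fun v y hv hvy => ?_⟩
  have hv0 : 0 < v := by linarith
  have h1 : ∑ d ∈ Sf v y, Λ d * (v / d - 1) ≤ Real.log v * v := by
    calc _ ≤ ∑ d ∈ Sf v y, Λ d * Psi (v / d) y := by
          refine Finset.sum_le_sum fun d hd => ?_
          refine mul_le_mul_of_nonneg_left (sub_one_le_Psi ?_) ArithmeticFunction.vonMangoldt_nonneg
          exact (div_le_self hv0.le (one_le_of_mem_Sf hd)).trans hvy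
      _ = ∑ n ∈ Sf v y, Real.log n := (sum_log_Sf_eq_sum_mul_Psi v y).symm
      _ ≤ Real.log v * Psi v y := sum_log_Sf_le v y
      _ ≤ _ := by
        gcongr
        · exact Real.log_nonneg hv
        · exact Psi_le_self hv0.le y
  have h2 : ∑ d ∈ Sf v y, Λ d * (v / d - 1) = v * ∑ d ∈ Sf v y, Λ d / d - friablePsi v y := by
    rw [friablePsi, Finset.mul_sum, ← Finset.sum_sub_distrib]
    refine Finset.sum_congr rfl fun d _ => ?_
    ring
  have h3 := (friablePsi_le_psi v y).trans (Chebyshev.psi_le_const_mul_self hv0.le)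
  have h5 : v * ∑ d ∈ Sf v y, Λ d / d ≤ v * (Real.log v + (Real.log 4 + 4)) := by linarith
  exact le_of_mul_le_mul_left h5 hv0

lemma log_div_four_le_sum_vonMangoldt_div {y : ℝ} (hy : 8 ≤ y) :
    Real.log y / 4 ≤ ∑ d ∈ Sf y y, Λ d / d := by
  have hy0 : 0 < y := by linarith
  have hs2 : √y * √y = y := Real.mul_self_sqrt hy0.le
  have hs0 : 0 < √y := Real.sqrt_pos.2 hy0
  have hsy : √y ≤ y / 2 - 1 := by nlinarith [sq_nonneg (√y - 2)]
  have hlog : 0 ≤ Real.log y := Real.log_nonneg (by linarith)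
  have hsub : Sf (√y) y ⊆ Sf y y := Sf_mono (by linarith) y
  have h1 : y / 2 * (Real.log y / 2) ≤ ∑ n ∈ Sf y y, Real.log n := by
    calc y / 2 * (Real.log y / 2) ≤ (Sf y y \ Sf (√y) y).card * (Real.log y / 2) := by
          gcongr
          have hc := Finset.card_sdiff_add_card_eq_card hsub
          have hc' : ((Sf y y \ Sf (√y) y).card : ℝ) + Psi (√y) y = Psi y y := by
            unfold Psi
            exact_mod_cast hc
          linarith [sub_one_le_Psi (le_refl y), Psi_le_self hs0.le y]
      _ ≤ ∑ n ∈ Sf y y \ Sf (√y) y, Real.log n := by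
          rw [← nsmul_eq_mul]
          refine Finset.card_nsmul_le_sum _ _ _ fun n hn => ?_
          obtain ⟨hn1, hn2⟩ := Finset.mem_sdiff.1 hn
          rw [← Real.log_sqrt hy0.le]
          refine Real.log_le_log hs0 ?_
          by_contra hlt
          exact hn2 (mem_Sf.2 ⟨(mem_Sf.1 hn1).1, (not_le.1 hlt).le, (mem_Sf.1 hn1).2.2⟩)
      _ ≤ _ := Finset.sum_le_sum_of_subset_of_nonneg Finset.sdiff_subset
          fun n hn _ => Real.log_nonneg (one_le_of_mem_Sf hn)
  have h2 : ∑ n ∈ Sf y y, Real.log n ≤ y * ∑ d ∈ Sf y y, Λ d / d := by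
    rw [sum_log_Sf_eq_sum_mul_Psi, Finset.mul_sum]
    refine Finset.sum_le_sum fun d _ => ?_
    calc Λ d * Psi (y / d) y ≤ Λ d * (y / d) :=
          mul_le_mul_of_nonneg_left (Psi_le_self (by positivity) y)
            ArithmeticFunction.vonMangoldt_nonneg
      _ = _ := by ring
  have h3 : y * (Real.log y / 4) ≤ y * ∑ d ∈ Sf y y, Λ d / d := by linarith
  exact le_of_mul_le_mul_left h3 hy0

/-- Divisors below a small power of `y` contribute a small proportion of the sum of `log n` over
the `y`-friable integers `n` up to `t`. -/
lemma exists_sum_vonMangoldt_mul_Psi_le :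
    ∃ C ≥ (1 : ℝ), ∀ ε : ℝ, 0 < ε → ε ≤ 1 / 16 → ∃ K ≥ (2 : ℝ), ∀ x y : ℝ, K ≤ y →
      K * Real.log y ≤ Real.log x → ∀ t ≤ x,
        ∑ d ∈ Sf (y ^ ε) y, Λ d * Psi (t / d) y ≤ C * ε * Real.log x * Psi t y := by
  obtain ⟨C, hC1, hC⟩ := exists_Psi_mul_le
  obtain ⟨M, hM0, hM⟩ := exists_sum_vonMangoldt_div_le
  refine ⟨16 * C ^ 2, by nlinarith, fun ε hε hε' =>
    ⟨max 8 (max ((C + 1) / ε) (Real.exp (M / ε))), le_max_of_le_left (by norm_num), ?_⟩⟩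
  intro x y hKy hKx t htx
  obtain ⟨hy8, hKy⟩ := max_le_iff.1 hKy
  obtain ⟨-, hyM⟩ := max_le_iff.1 hKy
  have hy0 : 0 < y := by linarith
  have hy1 : 1 ≤ y := by linarith
  have hlogy : 0 < Real.log y := Real.log_pos (by linarith)
  have hlogx : (C + 1) * Real.log y ≤ ε * Real.log x := by
    have : (C + 1) / ε * Real.log y ≤ Real.log x :=
      le_trans (mul_le_mul_of_nonneg_right ((le_max_left _ _).trans (le_max_right _ _)) hlogy.le)
        hKx
    rw [div_mul_eq_mul_div, div_le_iff₀ hε] at this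
    linarith
  have hlogx0 : 0 < Real.log x := by
    by_contra hneg
    nlinarith
  have hMy : M ≤ ε * Real.log y := by
    have := (Real.le_log_iff_exp_le hy0).2 hyM
    rwa [div_le_iff₀ hε, mul_comm] at this
  set w := y ^ ε with hw
  have hw1 : 1 ≤ w := Real.one_le_rpow hy1 hε.le
  have hw0 : 0 < w := by linarith
  have hwy : w ≤ y := by
    calc w ≤ y ^ (1 : ℝ) := Real.rpow_le_rpow_of_exponent_le hy1 (by linarith)
      _ = y := Real.rpow_one y
  have hlogw : Real.log w = ε * Real.log y := Real.log_rpow hy0 ε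
  have hP := Psi_nonneg t y
  have htriv : ∑ d ∈ Sf w y, Λ d * Psi (t / d) y ≤ Real.log t * Psi t y :=
    sum_mul_Psi_le fun d hd => (mem_Sf.1 hd).2.1.trans hwy
  rcases lt_or_ge t 1 with ht1 | ht1
  · rwa [Psi_eq_zero ht1, mul_zero] at htriv ⊢
  have ht0 : 0 < t := by linarith
  rcases lt_or_ge (Real.log t) ((C + 1) * Real.log y) with hlt | hge
  · refine htriv.trans (mul_le_mul_of_nonneg_right ?_ hP)
    have : ε * Real.log x ≤ 16 * C ^ 2 * (ε * Real.log x) :=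
      le_mul_of_one_le_left (by positivity) (by nlinarith)
    linarith
  have hPw := Psi_nonneg (t / w) y
  have hupper : ∑ d ∈ Sf w y, Λ d * Psi (t / d) y ≤
      C * (w * Psi (t / w) y) * (2 * (ε * Real.log y)) := by
    calc _ ≤ ∑ d ∈ Sf w y, C * (w * Psi (t / w) y) * (Λ d / d) := by
          refine Finset.sum_le_sum fun d hd => ?_
          have hd1 := one_le_of_mem_Sf hd
          have hd0 : (0 : ℝ) < d := by linarith
          have h := hC y (t / w) (w / d) (by linarith) (by positivity) (by
            rw [Real.log_div ht0.ne' hw0.ne', hlogw]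
            nlinarith) ((one_le_div hd0).2 (mem_Sf.1 hd).2.1)
            ((div_le_self hw0.le hd1).trans hwy)
          rw [show w / d * (t / w) = t / d by field_simp] at h
          calc _ ≤ Λ d * (C * (w / d * Psi (t / w) y)) :=
                mul_le_mul_of_nonneg_left h ArithmeticFunction.vonMangoldt_nonneg
            _ = _ := by ring
      _ = C * (w * Psi (t / w) y) * ∑ d ∈ Sf w y, Λ d / d := by rw [Finset.mul_sum]
      _ ≤ _ := by
        gcongr
        linarith [hM w y hw1 hwy]
  have hlower : w * Psi (t / w) y * (Real.log y / 8) ≤ C * (Real.log t * Psi t y) := by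
    have hsub : Sf w y ⊆ Sf y y := Sf_mono hwy y
    calc _ ≤ w * Psi (t / w) y * ∑ d ∈ Sf y y \ Sf w y, Λ d / d := by
          gcongr
          have h1 := Finset.sum_sdiff (f := fun d : ℕ => Λ d / (d : ℝ)) hsub
          have h2 := log_div_four_le_sum_vonMangoldt_div hy8
          have h3 := hM w y hw1 hwy
          nlinarith
      _ = ∑ d ∈ Sf y y \ Sf w y, Λ d * (w / d * Psi (t / w) y) := by
          rw [Finset.mul_sum]
          refine Finset.sum_congr rfl fun d _ => ?_
          ring
      _ ≤ ∑ d ∈ Sf y y \ Sf w y, C * (Λ d * Psi (t / d) y) := by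
          refine Finset.sum_le_sum fun d hd => ?_
          obtain ⟨hd1, hd2⟩ := Finset.mem_sdiff.1 hd
          have hdone := one_le_of_mem_Sf hd1
          have hd0 : (0 : ℝ) < d := by linarith
          have hdy : (d : ℝ) ≤ y := (mem_Sf.1 hd1).2.1
          have hdw : w ≤ d := by
            by_contra hlt
            exact hd2 (mem_Sf.2 ⟨(mem_Sf.1 hd1).1, (not_le.1 hlt).le, (mem_Sf.1 hd1).2.2⟩)
          have h := hC y (t / d) (d / w) (by linarith) (by positivity) (by
            rw [Real.log_div ht0.ne' hd0.ne']
            linarith [Real.log_le_log hd0 hdy]) ((one_le_div hw0).2 hdw)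
            ((div_le_self hd0.le hw1).trans hdy)
          rw [show d / w * (t / d) = t / w by field_simp] at h
          calc _ ≤ Λ d * (w / d * (C * (d / w * Psi (t / d) y))) := by
                refine mul_le_mul_of_nonneg_left ?_ ArithmeticFunction.vonMangoldt_nonneg
                gcongr
            _ = _ := by field_simp
      _ = C * ∑ d ∈ Sf y y \ Sf w y, Λ d * Psi (t / d) y := by rw [Finset.mul_sum]
      _ ≤ _ := by
        gcongr
        exact sum_mul_Psi_le fun d hd => (mem_Sf.1 (Finset.mem_sdiff.1 hd).1).2.1
  have htlog : Real.log t ≤ Real.log x := Real.log_le_log ht0 htx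
  calc _ ≤ _ := hupper
    _ = 16 * C * ε * (w * Psi (t / w) y * (Real.log y / 8)) := by ring
    _ ≤ 16 * C * ε * (C * (Real.log t * Psi t y)) := by gcongr
    _ ≤ 16 * C * ε * (C * (Real.log x * Psi t y)) := by gcongr
    _ = _ := by ring

/-- The part of `log n = ∑_{d ∣ n} Λ(d)` coming from divisors `d ≤ w`. -/
def smallLog (w : ℝ) (n : ℕ) : ℝ := ∑ d ∈ n.divisors with ((d : ℕ) : ℝ) ≤ w, Λ d

/-- The part of `log n = ∑_{d ∣ n} Λ(d)` coming from divisors `d > w`. -/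
def largeLog (w : ℝ) (n : ℕ) : ℝ := ∑ d ∈ n.divisors with ¬ ((d : ℕ) : ℝ) ≤ w, Λ d

lemma smallLog_add_largeLog (w : ℝ) (n : ℕ) : smallLog w n + largeLog w n = Real.log n := by
  rw [smallLog, largeLog, Finset.sum_filter_add_sum_filter_not,
    ArithmeticFunction.vonMangoldt_sum]

lemma smallLog_mul_le (w : ℝ) {d m : ℕ} (h : d * m ≠ 0) :
    smallLog w (d * m) ≤ smallLog w m + Real.log d := by
  have hd : (d : ℝ) ≠ 0 := Nat.cast_ne_zero.2 (left_ne_zero_of_mul h)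
  have hm : (m : ℝ) ≠ 0 := Nat.cast_ne_zero.2 (right_ne_zero_of_mul h)
  have h1 := smallLog_add_largeLog w (d * m)
  have h2 := smallLog_add_largeLog w m
  have h3 : largeLog w m ≤ largeLog w (d * m) :=
    Finset.sum_le_sum_of_subset_of_nonneg
      (Finset.filter_subset_filter _ (Nat.divisors_subset_of_dvd h (Nat.dvd_mul_left m d)))
      fun _ _ _ => ArithmeticFunction.vonMangoldt_nonneg
  rw [Nat.cast_mul, Real.log_mul hd hm] at h1
  linarith

/-- A falling factorial with step `W`, truncated at zero. -/
def truncFalling (W : ℝ) (j : ℕ) (s : ℝ) : ℝ := ∏ i ∈ Finset.range j, max (s - i * W) 0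

lemma truncFalling_nonneg (W : ℝ) (j : ℕ) (s : ℝ) : 0 ≤ truncFalling W j s :=
  Finset.prod_nonneg fun _ _ => le_max_right _ _

lemma truncFalling_mono (W : ℝ) (j : ℕ) {s s' : ℝ} (h : s ≤ s') :
    truncFalling W j s ≤ truncFalling W j s' :=
  Finset.prod_le_prod (fun _ _ => le_max_right _ _) fun _ _ => by gcongr

lemma truncFalling_succ (W : ℝ) (j : ℕ) (s : ℝ) :
    truncFalling W (j + 1) s = truncFalling W j (s - W) * max s 0 := by
  rw [truncFalling, Finset.prod_range_succ', truncFalling]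
  congr 1
  · refine Finset.prod_congr rfl fun i _ => ?_
    push_cast
    ring_nf
  · simp

lemma pow_le_truncFalling {W r s : ℝ} {j : ℕ} (hW : 0 ≤ W) (hr : 0 ≤ r) (h : r + j * W ≤ s) :
    r ^ j ≤ truncFalling W j s := by
  rw [truncFalling, ← Finset.card_range j, ← Finset.prod_const, Finset.card_range]
  refine Finset.prod_le_prod (fun _ _ => hr) fun i hi => le_max_of_le_left ?_
  have : (i : ℝ) ≤ j := by exact_mod_cast (Finset.mem_range.1 hi).le
  nlinarith

lemma sum_truncFalling_smallLog_le {x y w L : ℝ} (hx : 0 ≤ x) (hL : 0 ≤ L)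
    (h : ∀ t ≤ x, ∑ d ∈ Sf w y, Λ d * Psi (t / d) y ≤ L * Psi t y) (j : ℕ) :
    ∀ t ≤ x, ∑ n ∈ Sf t y, truncFalling (Real.log w) j (smallLog w n) ≤ L ^ j * Psi t y := by
  induction j with
  | zero =>
    intro t _
    simp [truncFalling, Psi]
  | succ j ih =>
    intro t ht
    have hstep : ∀ n ∈ Sf t y, truncFalling (Real.log w) (j + 1) (smallLog w n) ≤
        ∑ q ∈ n.divisorsAntidiagonal, if (q.1 : ℝ) ≤ w then
          Λ q.1 * truncFalling (Real.log w) j (smallLog w q.2) else 0 := by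
      intro n hn
      have hn0 : n ≠ 0 := (mem_Sf.1 hn).1
      have hs : 0 ≤ smallLog w n :=
        Finset.sum_nonneg fun _ _ => ArithmeticFunction.vonMangoldt_nonneg
      rw [truncFalling_succ, max_eq_left hs]
      have hsum : smallLog w n =
          ∑ q ∈ n.divisorsAntidiagonal, if (q.1 : ℝ) ≤ w then Λ q.1 else 0 := by
        rw [smallLog, Finset.sum_filter,
          Nat.sum_divisorsAntidiagonal fun d _ => if (d : ℝ) ≤ w then Λ d else 0]
      nth_rw 2 [hsum]
      rw [Finset.mul_sum]
      refine Finset.sum_le_sum fun q hq => ?_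
      obtain ⟨hqn, -⟩ := Nat.mem_divisorsAntidiagonal.1 hq
      split_ifs with hqw
      · rw [mul_comm]
        refine mul_le_mul_of_nonneg_left (truncFalling_mono _ _ ?_)
          ArithmeticFunction.vonMangoldt_nonneg
        have h0 : q.1 * q.2 ≠ 0 := hqn ▸ hn0
        have hq0 : (0 : ℝ) < q.1 := by
          exact_mod_cast Nat.pos_of_ne_zero (left_ne_zero_of_mul h0)
        have := smallLog_mul_le w h0
        rw [hqn] at this
        linarith [Real.log_le_log hq0 hqw]
      · rw [mul_zero]
    refine (Finset.sum_le_sum hstep).trans ?_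
    rw [sum_Sf_divisorsAntidiagonal t y fun d m => if (d : ℝ) ≤ w then
      Λ d * truncFalling (Real.log w) j (smallLog w m) else 0]
    have hnn : ∀ d : ℕ, 0 ≤ Λ d * (L ^ j * Psi (t / d) y) := fun d =>
      mul_nonneg ArithmeticFunction.vonMangoldt_nonneg (mul_nonneg (by positivity) (Psi_nonneg _ _))
    calc _ ≤ ∑ d ∈ Sf t y, if (d : ℝ) ≤ w then Λ d * (L ^ j * Psi (t / d) y) else 0 := by
          refine Finset.sum_le_sum fun d hd => ?_
          split_ifs with hdw
          · rw [← Finset.mul_sum]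
            refine mul_le_mul_of_nonneg_left (ih _ ?_) ArithmeticFunction.vonMangoldt_nonneg
            have hd1 := one_le_of_mem_Sf hd
            rw [div_le_iff₀ (by linarith)]
            nlinarith
          · simp
      _ = ∑ d ∈ Sf t y with ((d : ℕ) : ℝ) ≤ w, Λ d * (L ^ j * Psi (t / d) y) :=
          (Finset.sum_filter _ _).symm
      _ ≤ ∑ d ∈ Sf w y, Λ d * (L ^ j * Psi (t / d) y) := by
          refine Finset.sum_le_sum_of_subset_of_nonneg (fun d hd => ?_) fun d _ _ => hnn d
          obtain ⟨h1, h2⟩ := Finset.mem_filter.1 hd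
          exact mem_Sf.2 ⟨(mem_Sf.1 h1).1, h2, (mem_Sf.1 h1).2.2⟩
      _ = L ^ j * ∑ d ∈ Sf w y, Λ d * Psi (t / d) y := by
          rw [Finset.mul_sum]
          refine Finset.sum_congr rfl fun d _ => ?_
          ring
      _ ≤ L ^ j * (L * Psi t y) := by
          gcongr
          exact h t ht
      _ = _ := by ring

/-- Markov's inequality for the truncated factorial moments of `smallLog`. -/
lemma card_le_smallLog_mul_pow_le {x y w L r s : ℝ} {j : ℕ} (hx : 0 ≤ x) (hL : 0 ≤ L)
    (h : ∀ t ≤ x, ∑ d ∈ Sf w y, Λ d * Psi (t / d) y ≤ L * Psi t y)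
    (hw : 1 ≤ w) (hr : 0 ≤ r) (hs : r + j * Real.log w ≤ s) :
    (((Sf x y).filter fun n => s ≤ smallLog w n).card : ℝ) * r ^ j ≤ L ^ j * Psi x y := by
  refine le_trans ?_ (sum_truncFalling_smallLog_le hx hL h j x le_rfl)
  calc _ ≤ ∑ n ∈ Sf x y with s ≤ smallLog w n, truncFalling (Real.log w) j (smallLog w n) := by
        rw [← nsmul_eq_mul]
        refine Finset.card_nsmul_le_sum _ _ _ fun n hn => ?_
        exact pow_le_truncFalling (Real.log_nonneg hw) hr
          (hs.trans (Finset.mem_filter.1 hn).2)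
    _ ≤ _ := Finset.sum_le_sum_of_subset_of_nonneg (Finset.filter_subset _ _)
        fun _ _ _ => truncFalling_nonneg _ _ _

lemma sum_factorization_mul_log {n : ℕ} (hn : n ≠ 0) :
    ∑ p ∈ n.primeFactors, (n.factorization p : ℝ) * Real.log p = Real.log n := by
  conv_rhs => rw [← Nat.prod_factorization_pow_eq_self hn]
  rw [Finsupp.prod, Nat.support_factorization, Nat.cast_prod, Real.log_prod]
  · refine Finset.sum_congr rfl fun p _ => ?_
    rw [Nat.cast_pow, Real.log_pow]
  · intro p hp
    exact_mod_cast pow_ne_zero _ (Nat.prime_of_mem_primeFactors hp).ne_zero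

lemma largeLog_le_sum {w : ℝ} {n : ℕ} (hn : n ≠ 0) :
    largeLog w n ≤ ∑ p ∈ n.primeFactors with w < (((p : ℕ) ^ n.factorization p : ℕ) : ℝ),
      (n.factorization p : ℝ) * Real.log p := by
  set F := n.primeFactors.filter fun p : ℕ => w < ((p ^ n.factorization p : ℕ) : ℝ) with hF
  have hpr : ∀ p ∈ F, p ^ n.factorization p ≠ 0 := fun p hp =>
    pow_ne_zero _ (Nat.prime_of_mem_primeFactors (Finset.mem_filter.1 hp).1).ne_zero
  have hprod : ∏ p ∈ F, p ^ n.factorization p ≠ 0 := Finset.prod_ne_zero_iff.2 hpr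
  have hlog : ∑ p ∈ F, (n.factorization p : ℝ) * Real.log p =
      ∑ d ∈ (∏ p ∈ F, p ^ n.factorization p).divisors, Λ d := by
    rw [ArithmeticFunction.vonMangoldt_sum, Nat.cast_prod, Real.log_prod]
    · refine Finset.sum_congr rfl fun p _ => ?_
      rw [Nat.cast_pow, Real.log_pow]
    · intro p hp
      exact_mod_cast hpr p hp
  rw [hlog, largeLog, ← Finset.sum_filter_ne_zero]
  refine Finset.sum_le_sum_of_subset_of_nonneg (fun d hd => ?_) fun _ _ _ =>
    ArithmeticFunction.vonMangoldt_nonneg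
  simp only [Finset.mem_filter, Nat.mem_divisors, not_le] at hd
  obtain ⟨⟨⟨hdn, -⟩, hwd⟩, hne⟩ := hd
  obtain ⟨p, k, pp, hk, rfl⟩ :=
    (isPrimePow_nat_iff _).1 (ArithmeticFunction.vonMangoldt_ne_zero_iff.1 hne)
  have hkle : k ≤ n.factorization p := (pp.pow_dvd_iff_le_factorization hn).1 hdn
  have hpF : p ∈ F := by
    refine Finset.mem_filter.2 ⟨Nat.mem_primeFactors.2 ⟨pp, (dvd_pow_self p hk.ne').trans hdn, hn⟩,
      lt_of_lt_of_le hwd ?_⟩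
    exact_mod_cast Nat.pow_le_pow_right pp.pos hkle
  exact Nat.mem_divisors.2
    ⟨(pow_dvd_pow p hkle).trans (Finset.dvd_prod_of_mem (fun p => p ^ n.factorization p) hpF),
      hprod⟩

lemma card_mul_log_le {w : ℝ} {n : ℕ} (hw : 1 ≤ w) (hn : n ≠ 0) :
    ((n.primeFactors.filter fun p : ℕ => w < ((p ^ n.factorization p : ℕ) : ℝ)).card : ℝ) *
      Real.log w ≤ Real.log n := by
  rw [← sum_factorization_mul_log hn, ← nsmul_eq_mul]
  refine (Finset.card_nsmul_le_sum _ _ _ fun p hp => ?_).trans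
    (Finset.sum_le_sum_of_subset_of_nonneg (Finset.filter_subset _ _) fun p _ _ =>
      mul_nonneg (Nat.cast_nonneg _) (Real.log_natCast_nonneg p))
  rw [← Real.log_pow, ← Nat.cast_pow]
  exact Real.log_le_log (by linarith) (Finset.mem_filter.1 hp).2.le

lemma pow_div_pow_le_fk {k n : ℕ} {s N : ℝ} {F : Finset ℕ} (hk : 1 ≤ k)
    (hF : F ⊆ n.primeFactors) (hs : 0 ≤ s)
    (hsF : s ≤ ∑ p ∈ F, (n.factorization p : ℝ) * Real.log p) (hN : 0 < N)
    (hFN : (F.card : ℝ) ≤ N) :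
    s ^ k / N ^ (k - 1) ≤ fk k n := by
  obtain ⟨k, rfl⟩ := Nat.exists_eq_add_of_le' hk
  rw [Nat.add_sub_cancel]
  have hnn : ∀ p : ℕ, 0 ≤ (n.factorization p : ℝ) * Real.log p := fun p =>
    mul_nonneg (Nat.cast_nonneg _) (Real.log_natCast_nonneg p)
  have hsub : ∑ p ∈ F, ((n.factorization p : ℝ) * Real.log p) ^ (k + 1) ≤ fk (k + 1) n :=
    Finset.sum_le_sum_of_subset_of_nonneg hF fun p _ _ => pow_nonneg (hnn p) _
  refine le_trans ?_ hsub
  rw [div_le_iff₀ (by positivity), mul_comm]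
  calc s ^ (k + 1) ≤ (∑ p ∈ F, (n.factorization p : ℝ) * Real.log p) ^ (k + 1) := by gcongr
    _ ≤ (F.card : ℝ) ^ k * ∑ p ∈ F, ((n.factorization p : ℝ) * Real.log p) ^ (k + 1) :=
      pow_sum_le_card_mul_sum_pow (fun p _ => hnn p) k
    _ ≤ _ := by gcongr

lemma one_le_ubar {x y : ℝ} (hy : 2 ≤ y) (hxy : y ≤ x) : 1 ≤ ubar x y := by
  refine le_min ?_ (one_le_card_primesUpTo hy)
  rw [uQ, one_le_div (Real.log_pos (by linarith))]
  exact Real.log_le_log (by linarith) hxy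

lemma card_primesUpTo_le {y : ℝ} (hy : 0 ≤ y) : ((primesUpTo y).card : ℝ) ≤ y := by
  refine le_trans ?_ (Nat.floor_le hy)
  have h : primesUpTo y ⊆ Finset.Icc 1 ⌊y⌋₊ := fun p hp => by
    obtain ⟨pp, hpy⟩ := mem_primesUpTo.1 hp
    exact Finset.mem_Icc.2 ⟨pp.one_lt.le, Nat.le_floor hpy⟩
  have := Finset.card_le_card h
  rw [Nat.card_Icc, Nat.add_sub_cancel] at this
  exact_mod_cast this

lemma le_fk_of_smallLog_lt {x y ε : ℝ} {k n : ℕ} (hk : 1 ≤ k) (hy : 2 ≤ y) (hxy : y ≤ x)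
    (hε : 0 < ε) (hε1 : ε ≤ 1) (hn : n ∈ Sf x y) (hlog : Real.log x / 2 ≤ Real.log n)
    (hsmall : smallLog (y ^ ε) n < Real.log x / 4) :
    (Real.log x / 4) ^ k / (ubar x y / ε) ^ (k - 1) ≤ fk k n := by
  obtain ⟨hn0, hnx, hny⟩ := mem_Sf.1 hn
  have hu := one_le_ubar hy hxy
  have hly : 0 < Real.log y := Real.log_pos (by linarith)
  have hlx : 0 ≤ Real.log x := Real.log_nonneg (by linarith)
  have hN : 0 < ubar x y / ε := by positivity
  have hw1 : (1 : ℝ) ≤ y ^ ε := Real.one_le_rpow (by linarith) hε.le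
  rcases le_total (uQ x y) (primesUpTo y).card with h | h
  · refine pow_div_pow_le_fk hk (Finset.filter_subset _ _) (by positivity)
      (le_trans ?_ (largeLog_le_sum (w := y ^ ε) hn0)) hN ?_
    · linarith [smallLog_add_largeLog (y ^ ε) n]
    · rw [ubar, min_eq_left h, uQ, div_div, le_div_iff₀ (by positivity), mul_comm (Real.log y),
        ← Real.log_rpow (by linarith)]
      exact (card_mul_log_le hw1 hn0).trans
        (Real.log_le_log (by exact_mod_cast Nat.pos_of_ne_zero hn0) hnx)
  · refine pow_div_pow_le_fk hk (Finset.Subset.refl _) (by positivity) ?_ hN ?_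
    · rw [sum_factorization_mul_log hn0]
      linarith
    · have hsub : n.primeFactors ⊆ primesUpTo y := fun p hp =>
        mem_primesUpTo.2 ⟨Nat.prime_of_mem_primeFactors hp,
          hny p (Nat.prime_of_mem_primeFactors hp) (Nat.dvd_of_mem_primeFactors hp)⟩
      rw [le_div_iff₀ hε, ubar, min_eq_right h]
      have : (n.primeFactors.card : ℝ) ≤ (primesUpTo y).card := by
        exact_mod_cast Finset.card_le_card hsub
      nlinarith [Nat.cast_nonneg (α := ℝ) n.primeFactors.card]

lemma half_pow_floor_le (v : ℝ) :
    (1 / 2 : ℝ) ^ ⌊v / 8⌋₊ ≤ 2 * Real.exp (-(Real.log 2 / 8) * v) := by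
  have h : v / 8 - 1 ≤ (⌊v / 8⌋₊ : ℝ) := by linarith [Nat.lt_floor_add_one (v / 8)]
  have h2 : (1 / 2 : ℝ) ^ ⌊v / 8⌋₊ = Real.exp (-(⌊v / 8⌋₊ * Real.log 2)) := by
    rw [← Real.log_pow, Real.exp_neg, Real.exp_log (by positivity), one_div, inv_pow]
  have h3 : 2 * Real.exp (-(Real.log 2 / 8) * v) =
      Real.exp (Real.log 2 + -(Real.log 2 / 8) * v) := by
    rw [Real.exp_add, Real.exp_log two_pos]
  rw [h2, h3]
  refine Real.exp_le_exp.2 ?_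
  nlinarith [Real.log_pos one_lt_two]

/-- Friable integers `n` with `log n < (log x) / 2` are rare. -/
lemma card_log_lt_le {x y : ℝ} (hy : 2 ≤ y) (hxy : y ≤ x) :
    (((Sf x y).filter fun n : ℕ => Real.log n < Real.log x / 2).card : ℝ) ≤
      (1 / 2) ^ ⌊ubar x y / 8⌋₊ * Psi x y := by
  have hu := one_le_ubar hy hxy
  have hu0 : 0 < ubar x y := by linarith
  have hly : 0 < Real.log y := Real.log_pos (by linarith)
  have hlx : 0 ≤ Real.log x := Real.log_nonneg (by linarith)
  have hx0 : 0 < x := by linarith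
  set z := Real.exp (Real.log x / ubar x y) with hz
  have hlz : Real.log z = Real.log x / ubar x y := Real.log_exp _
  have hz0 : 0 < z := Real.exp_pos _
  have hyz : y ≤ z := by
    rw [← Real.log_le_iff_le_exp (by linarith), le_div_iff₀ hu0, mul_comm, ← le_div_iff₀ hly]
    exact min_le_left _ _
  have hxz : Real.log x ≤ (primesUpTo y).card * Real.log z := by
    rw [hlz, ← mul_div_assoc, le_div_iff₀ hu0, mul_comm]
    exact mul_le_mul_of_nonneg_right (min_le_right _ _) hlx
  refine le_trans ?_ (Psi_div_pow_le hx0 hy hyz hxz ⌊ubar x y / 8⌋₊)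
  rw [Psi]
  refine Nat.cast_le.2 (Finset.card_le_card fun n hn => ?_)
  obtain ⟨hnS, hlog⟩ := Finset.mem_filter.1 hn
  obtain ⟨hn0, -, hny⟩ := mem_Sf.1 hnS
  refine mem_Sf.2 ⟨hn0, ?_, hny⟩
  have hn0' : (0 : ℝ) < n := by exact_mod_cast Nat.pos_of_ne_zero hn0
  rw [← Real.log_le_log_iff hn0' (by positivity), Real.log_div hx0.ne' (by positivity),
    Real.log_pow, Real.log_pow, hlz]
  have hj : (⌊ubar x y / 8⌋₊ : ℝ) ≤ ubar x y / 8 := Nat.floor_le (by positivity)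
  have : (⌊ubar x y / 8⌋₊ : ℝ) * ((4 : ℕ) * (Real.log x / ubar x y)) ≤
      ubar x y / 8 * ((4 : ℕ) * (Real.log x / ubar x y)) := by gcongr
  have h2 : ubar x y / 8 * ((4 : ℕ) * (Real.log x / ubar x y)) = Real.log x / 2 := by
    push_cast
    ring_nf
    field_simp
  linarith

/-- Friable integers whose small prime powers contribute a quarter of `log x` are rare. -/
lemma card_le_smallLog_le {x y ε L : ℝ} (hy : 2 ≤ y) (hxy : y ≤ x) (hε : 0 ≤ ε) (hε1 : ε ≤ 1)
    (hL : L = Real.log x / 16)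
    (h : ∀ t ≤ x, ∑ d ∈ Sf (y ^ ε) y, Λ d * Psi (t / d) y ≤ L * Psi t y) :
    (((Sf x y).filter fun n => Real.log x / 4 ≤ smallLog (y ^ ε) n).card : ℝ) ≤
      (1 / 2) ^ ⌊ubar x y / 8⌋₊ * Psi x y := by
  have hu := one_le_ubar hy hxy
  have hly : 0 < Real.log y := Real.log_pos (by linarith)
  have hlx : 0 < Real.log x := Real.log_pos (by linarith)
  have hj : (⌊ubar x y / 8⌋₊ : ℝ) ≤ ubar x y / 8 := Nat.floor_le (by positivity)
  have huy : ubar x y * Real.log y ≤ Real.log x := by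
    rw [← le_div_iff₀ hly]
    exact min_le_left _ _
  have hs : Real.log x / 8 + ⌊ubar x y / 8⌋₊ * Real.log (y ^ ε) ≤ Real.log x / 4 := by
    rw [Real.log_rpow (by linarith)]
    have h1 : ε * Real.log y ≤ Real.log y := mul_le_of_le_one_left hly.le hε1
    have h2 : (⌊ubar x y / 8⌋₊ : ℝ) * (ε * Real.log y) ≤ ubar x y / 8 * Real.log y := by gcongr
    linarith
  have hcard := card_le_smallLog_mul_pow_le (by linarith) (by rw [hL]; positivity) h
    (Real.one_le_rpow (by linarith) hε) (by positivity) hs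
  have hpow : L ^ ⌊ubar x y / 8⌋₊ =
      (1 / 2) ^ ⌊ubar x y / 8⌋₊ * (Real.log x / 8) ^ ⌊ubar x y / 8⌋₊ := by
    rw [← mul_pow, hL]
    ring
  rw [hpow, mul_right_comm] at hcard
  exact le_of_mul_le_mul_right hcard (by positivity)

/-- **Lemma 3.2**: normal lower bound for `f_k(n)`. -/
theorem stmt8 :
    ∃ c₁ > (0:ℝ), ∀ k : ℕ, 1 ≤ k → ∃ ck > (0:ℝ), ∃ Ck > (0:ℝ),
      ∀ x y : ℝ, 2 ≤ y → y ≤ x →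
        (((Sf x y).filter fun n =>
            fk k n < ck * Real.log x ^ k / ubar x y ^ (k - 1)).card : ℝ) ≤
          Ck * Real.exp (-c₁ * ubar x y) * Psi x y := by
  obtain ⟨C, hC, hmain⟩ := exists_sum_vonMangoldt_mul_Psi_le
  obtain ⟨ε, hεdef⟩ : ∃ ε : ℝ, ε = 1 / (16 * C) := ⟨_, rfl⟩
  have hε : 0 < ε := by rw [hεdef]; positivity
  have hε16 : ε ≤ 1 / 16 := hεdef.trans_le <| one_div_le_one_div_of_le (by norm_num) (by linarith)
  obtain ⟨K, hK, hmain⟩ := hmain ε hε hε16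
  have hc₁ : 0 < Real.log 2 / 8 := div_pos (Real.log_pos one_lt_two) (by norm_num)
  refine ⟨Real.log 2 / 8, hc₁, fun k hk => ⟨ε ^ (k - 1) / 4 ^ k, by positivity,
    4 * Real.exp (Real.log 2 / 8 * K), by positivity, fun x y hy hxy => ?_⟩⟩
  have hu := one_le_ubar hy hxy
  have hly : 0 < Real.log y := Real.log_pos (by linarith)
  have hPsi := Psi_nonneg x y
  rcases lt_or_ge (ubar x y) K with huK | huK
  · have h1 : (1 : ℝ) ≤ 4 * Real.exp (Real.log 2 / 8 * K) *
        Real.exp (-(Real.log 2 / 8) * ubar x y) := by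
      rw [mul_assoc, ← Real.exp_add]
      have : (1 : ℝ) ≤ Real.exp (Real.log 2 / 8 * K + -(Real.log 2 / 8) * ubar x y) :=
        Real.one_le_exp (by nlinarith)
      linarith
    refine le_trans ?_ (le_mul_of_one_le_left hPsi h1)
    exact Nat.cast_le.2 (Finset.card_filter_le _ _)
  have hKy : K ≤ y := huK.trans ((min_le_right _ _).trans (card_primesUpTo_le (by linarith)))
  have hKx : K * Real.log y ≤ Real.log x := by
    rw [← le_div_iff₀ hly]
    exact huK.trans (min_le_left _ _)
  have hsub : ((Sf x y).filter fun n =>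
      fk k n < ε ^ (k - 1) / 4 ^ k * Real.log x ^ k / ubar x y ^ (k - 1)) ⊆
      ((Sf x y).filter fun n : ℕ => Real.log n < Real.log x / 2) ∪
        (Sf x y).filter fun n => Real.log x / 4 ≤ smallLog (y ^ ε) n := by
    intro n hn
    obtain ⟨hnS, hlt⟩ := Finset.mem_filter.1 hn
    by_contra! hnot
    simp only [Finset.mem_union, Finset.mem_filter, hnS, true_and, not_or, not_lt, not_le] at hnot
    refine hlt.not_ge (le_trans (le_of_eq ?_)
      (le_fk_of_smallLog_lt hk hy hxy hε (by linarith) hnS hnot.1 hnot.2))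
    rw [div_pow, div_pow]
    field_simp
  have hL : C * ε * Real.log x = Real.log x / 16 := by
    rw [hεdef]
    field_simp
  have hsmall := card_le_smallLog_le hy hxy hε.le (by linarith) hL (hmain x y hKy hKx)
  have hlog := card_log_lt_le hy hxy
  have hexp : (1 : ℝ) ≤ Real.exp (Real.log 2 / 8 * K) := Real.one_le_exp (by nlinarith)
  calc _ ≤ (((Sf x y).filter fun n : ℕ => Real.log n < Real.log x / 2).card : ℝ) +
        ((Sf x y).filter fun n => Real.log x / 4 ≤ smallLog (y ^ ε) n).card := by
        exact_mod_cast (Finset.card_le_card hsub).trans (Finset.card_union_le _ _)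
    _ ≤ 2 * ((1 / 2) ^ ⌊ubar x y / 8⌋₊ * Psi x y) := by linarith
    _ ≤ 2 * (2 * Real.exp (-(Real.log 2 / 8) * ubar x y) * Psi x y) := by
        gcongr
        exact half_pow_floor_le _
    _ = 4 * 1 * Real.exp (-(Real.log 2 / 8) * ubar x y) * Psi x y := by ring
    _ ≤ _ := by gcongr

end
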